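/- For every n ≥ 1 and every nonempty rational polyhedron P ⊆ [0,1]^n, the finitely presented MV-algebra McN(P) is hopfian: every surjective MV-endomorphism of McN(P) is injective. In particular, the free n-generator MV-algebra McN([0,1]^n) is hopfian. -/

import Mathlib

open Set BigOperators

/-- The unit cube `[0,1]^n` as a subset of `Fin n → ℝ`. -/
def cube (n : ℕ) : Set (Fin n → ℝ) := Set.Icc 0 1

/-- An (affine) linear polynomial with integer coefficients. -/
def IsAffineZ {n : ℕ} (p : (Fin n → ℝ) → ℝ) : Prop :=
  ∃ (m : ℤ) (c : Fin n → ℤ), ∀ x, p x = (m : ℝ) + ∑ i, (c i : ℝ) * x i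

/-- A McNaughton function on `[0,1]^n`: continuous, `[0,1]`-valued, and agreeing at each
point of the cube with one of finitely many affine polynomials with integer coefficients. -/
def IsMcNaughton {n : ℕ} (f : (Fin n → ℝ) → ℝ) : Prop :=
  ContinuousOn f (cube n) ∧ (∀ x ∈ cube n, f x ∈ Set.Icc (0:ℝ) 1) ∧
  ∃ (u : ℕ) (p : Fin u → (Fin n → ℝ) → ℝ),
    (∀ j, IsAffineZ (p j)) ∧ ∀ x ∈ cube n, ∃ j, f x = p j x

/-- `McN X`: restrictions to `X` of McNaughton functions on `[0,1]^n`. -/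
def McN {n : ℕ} (X : Set (Fin n → ℝ)) : Set (↥X → ℝ) :=
  {g : ↥X → ℝ | ∃ f, IsMcNaughton (n := n) f ∧ ∀ x : X, g x = f x.1}

/-- Pointwise MV-negation `¬f = 1 - f`. -/
def mvNeg {α : Type*} (f : α → ℝ) : α → ℝ := fun x => 1 - f x

/-- Pointwise MV-sum `f ⊕ g = min(1, f + g)`. -/
def mvOplus {α : Type*} (f g : α → ℝ) : α → ℝ := fun x => min 1 (f x + g x)

/-- A point all of whose coordinates are rational. -/
def IsRationalPoint {n : ℕ} (x : Fin n → ℝ) : Prop := ∀ i, ∃ q : ℚ, x i = (q : ℝ)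

/-- An MV-endomorphism of `McN X`. -/
def IsMVEndo {n : ℕ} (X : Set (Fin n → ℝ)) (σ : (↥X → ℝ) → (↥X → ℝ)) : Prop :=
  Set.MapsTo σ (McN X) (McN X) ∧
  σ (fun _ => 0) = (fun _ => 0) ∧
  (∀ f ∈ McN X, σ (mvNeg f) = mvNeg (σ f)) ∧
  (∀ f ∈ McN X, ∀ g ∈ McN X, σ (mvOplus f g) = mvOplus (σ f) (σ g))

/-- A rational polyhedron in `[0,1]^n`: a finite union of convex hulls of finite sets of
rational points of `[0,1]^n`. -/
def IsRatPolyhedron {n : ℕ} (P : Set (Fin n → ℝ)) : Prop :=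
  ∃ F : Finset (Finset (Fin n → ℝ)),
    (∀ S ∈ F, ∀ v ∈ S, IsRationalPoint v ∧ v ∈ cube n) ∧
    P = ⋃ S ∈ F, convexHull ℝ (S : Set (Fin n → ℝ))

theorem IsMcNaughton.of_finite {n : ℕ} {f : (Fin n → ℝ) → ℝ} {ι : Type*} [Finite ι]
    (p : ι → (Fin n → ℝ) → ℝ) (hc : ContinuousOn f (cube n))
    (hf : ∀ x ∈ cube n, f x ∈ Set.Icc (0:ℝ) 1) (hp : ∀ j, IsAffineZ (p j))
    (h : ∀ x ∈ cube n, ∃ j, f x = p j x) : IsMcNaughton f := by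
  obtain ⟨u, ⟨e⟩⟩ := Finite.exists_equiv_fin ι
  refine ⟨hc, hf, u, fun j => p (e.symm j), fun j => hp _, fun x hx => ?_⟩
  obtain ⟨j, hj⟩ := h x hx
  exact ⟨e j, by simpa using hj⟩

theorem isAffineZ_const {n : ℕ} (m : ℤ) : IsAffineZ (fun _ : Fin n → ℝ => (m : ℝ)) :=
  ⟨m, 0, fun x => by simp⟩

theorem isAffineZ_apply {n : ℕ} (i : Fin n) : IsAffineZ (fun x : Fin n → ℝ => x i) :=
  ⟨0, Pi.single i 1, fun x => by simp [Pi.single_apply]⟩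

theorem IsAffineZ.add {n : ℕ} {p q : (Fin n → ℝ) → ℝ} (hp : IsAffineZ p) (hq : IsAffineZ q) :
    IsAffineZ (fun x => p x + q x) := by
  obtain ⟨m, c, h⟩ := hp
  obtain ⟨m', c', h'⟩ := hq
  refine ⟨m + m', c + c', fun x => ?_⟩
  simp only [h, h', Pi.add_apply, Int.cast_add, add_mul, Finset.sum_add_distrib]
  ring

theorem IsAffineZ.neg {n : ℕ} {p : (Fin n → ℝ) → ℝ} (hp : IsAffineZ p) :
    IsAffineZ (fun x => -p x) := by
  obtain ⟨m, c, h⟩ := hp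
  refine ⟨-m, -c, fun x => ?_⟩
  simp only [h, Pi.neg_apply, Int.cast_neg, neg_mul, Finset.sum_neg_distrib]
  ring

/-- Affine maps with integer coefficients preserve the lattice `(1/d) ℤ`. -/
theorem IsAffineZ.exists_int_mul {n : ℕ} {p : (Fin n → ℝ) → ℝ} (hp : IsAffineZ p) (d : ℕ)
    {x : Fin n → ℝ} (hx : ∀ i, ∃ z : ℤ, (d : ℝ) * x i = z) : ∃ z : ℤ, (d : ℝ) * p x = z := by
  obtain ⟨m, c, h⟩ := hp
  choose z hz using hx
  refine ⟨d * m + ∑ i, c i * z i, ?_⟩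
  rw [h, mul_add, Finset.mul_sum]
  push_cast
  congr 1
  refine Finset.sum_congr rfl fun i _ => ?_
  rw [← hz]
  ring

section McN

variable {n : ℕ} {P : Set (Fin n → ℝ)}

theorem McN.zero_mem : (fun _ : P => (0 : ℝ)) ∈ McN P :=
  ⟨fun _ => 0, .of_finite (fun _ : Unit => fun _ => ((0 : ℤ) : ℝ)) continuousOn_const
    (fun _ _ => by simp) (fun _ => isAffineZ_const 0) (fun _ _ => ⟨(), by simp⟩), fun _ => rfl⟩

theorem McN.apply_mem (i : Fin n) : (fun x : P => x.1 i) ∈ McN P :=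
  ⟨fun x => x i, .of_finite (fun _ : Unit => fun x => x i) (continuous_apply i).continuousOn
    (fun _ hx => ⟨hx.1 i, hx.2 i⟩) (fun _ => isAffineZ_apply i) (fun _ _ => ⟨(), rfl⟩),
    fun _ => rfl⟩

theorem McN.neg_mem {f : P → ℝ} (hf : f ∈ McN P) : mvNeg f ∈ McN P := by
  obtain ⟨F, ⟨hc, hb, u, p, hp, hF⟩, h⟩ := hf
  refine ⟨fun x => 1 - F x, .of_finite (fun j x => ((1 : ℤ) : ℝ) + -p j x)
    (continuousOn_const.sub hc) (fun x hx => ?_) (fun j => (isAffineZ_const 1).add (hp j).neg)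
    (fun x hx => ?_), fun x => by simp [mvNeg, h]⟩
  · have := hb x hx
    constructor <;> linarith [this.1, this.2]
  · obtain ⟨j, hj⟩ := hF x hx
    exact ⟨j, by simp [hj, sub_eq_add_neg]⟩

theorem McN.oplus_mem {f g : P → ℝ} (hf : f ∈ McN P) (hg : g ∈ McN P) :
    mvOplus f g ∈ McN P := by
  obtain ⟨F, ⟨hc, hb, u, p, hp, hF⟩, h⟩ := hf
  obtain ⟨G, ⟨hc', hb', v, q, hq, hG⟩, h'⟩ := hg
  refine ⟨fun x => min 1 (F x + G x), .of_finite
    (fun j : Option (Fin u × Fin v) => j.elim (fun _ => ((1 : ℤ) : ℝ)) fun j x => p j.1 x + q j.2 x)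
    (continuousOn_const.inf (hc.add hc')) (fun x hx => ?_) (fun j => ?_)
    (fun x hx => ?_), fun x => by simp [mvOplus, h, h']⟩
  · exact ⟨le_min zero_le_one (add_nonneg (hb x hx).1 (hb' x hx).1), min_le_left _ _⟩
  · cases j with
    | none => exact isAffineZ_const 1
    | some j => exact (hp j.1).add (hq j.2)
  · obtain ⟨j, hj⟩ := hF x hx
    obtain ⟨k, hk⟩ := hG x hx
    rcases le_total 1 (F x + G x) with hle | hle
    · exact ⟨none, by simp [hle]⟩
    · exact ⟨some (j, k), by simp [hle, ← hj, ← hk]⟩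

theorem McN.mem_Icc (hP : P ⊆ cube n) {f : P → ℝ} (hf : f ∈ McN P) (x : P) :
    f x ∈ Set.Icc (0 : ℝ) 1 := by
  obtain ⟨F, hF, h⟩ := hf
  exact h x ▸ hF.2.1 x (hP x.2)

theorem McN.continuous (hP : P ⊆ cube n) {f : P → ℝ} (hf : f ∈ McN P) : Continuous f := by
  obtain ⟨F, hF, h⟩ := hf
  rw [funext h]
  exact (hF.1.mono hP).domRestrict

theorem McN.exists_int_mul (hP : P ⊆ cube n) {f : P → ℝ} (hf : f ∈ McN P) (d : ℕ) {x : P}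
    (hx : ∀ i, ∃ z : ℤ, (d : ℝ) * x.1 i = z) : ∃ z : ℤ, (d : ℝ) * f x = z := by
  obtain ⟨F, ⟨-, -, u, p, hp, hF⟩, h⟩ := hf
  obtain ⟨j, hj⟩ := hF x (hP x.2)
  rw [h, hj]
  exact (hp j).exists_int_mul d hx

end McN

/-- Truncation of a real number to the unit interval. -/
def unitClip (t : ℝ) : ℝ := max 0 (min 1 t)

theorem unitClip_add (t : ℝ) {y : ℝ} (hy : y ∈ Set.Icc (0 : ℝ) 1) :
    unitClip (t + y) = 1 - min 1 ((1 - min 1 (unitClip t + y)) + (1 - unitClip (t + 1))) := by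
  obtain ⟨h0, h1⟩ := hy
  unfold unitClip
  grind

section Endo

variable {n : ℕ} {P : Set (Fin n → ℝ)} {σ : (P → ℝ) → (P → ℝ)}

/-- The MV-terms truncating `q • f - p` are in `McN P` and commute with endomorphisms. -/
theorem IsMVEndo.map_unitClip (hP : P ⊆ cube n) (hσ : IsMVEndo P σ) {f : P → ℝ} (hf : f ∈ McN P)
    (q : ℕ) (p : ℤ) :
    (fun x => unitClip (q * f x - p)) ∈ McN P ∧
      σ (fun x => unitClip (q * f x - p)) = fun x => unitClip (q * σ f x - p) := by
  obtain ⟨hmaps, hzero, hneg, hadd⟩ := hσ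
  induction q generalizing p with
  | zero =>
    rcases le_or_gt 0 p with hp | hp
    · have : unitClip (-(p : ℝ)) = 0 := by
        have : (0 : ℝ) ≤ p := by exact_mod_cast hp
        unfold unitClip
        grind
      simpa [this] using ⟨McN.zero_mem, hzero⟩
    · have : unitClip (-(p : ℝ)) = 1 := by
        have : (p : ℝ) ≤ -1 := by exact_mod_cast (by lia : p ≤ -1)
        unfold unitClip
        grind
      have h0 := McN.neg_mem (McN.zero_mem (P := P))
      have h1 := hneg _ McN.zero_mem
      rw [hzero] at h1
      have hone : mvNeg (fun _ : P => (0 : ℝ)) = fun _ => 1 := funext fun _ => sub_zero 1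
      rw [hone] at h0 h1
      simpa [this] using ⟨h0, h1⟩
  | succ q ih =>
    have key : ∀ g ∈ McN P, (fun x => unitClip ((q + 1 : ℕ) * g x - p)) =
        mvNeg (mvOplus (mvNeg (mvOplus (fun x => unitClip (q * g x - p)) g))
          (mvNeg fun x => unitClip (q * g x - (p - 1 : ℤ)))) := by
      intro g hg
      funext x
      have := unitClip_add (q * g x - p) (McN.mem_Icc hP hg x)
      simp only [mvNeg, mvOplus]
      convert this using 3
      · push_cast
        ring
      · push_cast
        ring_nf
    obtain ⟨ha, ha'⟩ := ih p
    obtain ⟨hb, hb'⟩ := ih (p - 1)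
    have h1 := McN.oplus_mem ha hf
    have h2 := McN.neg_mem h1
    have h3 := McN.neg_mem hb
    have h4 := McN.oplus_mem h2 h3
    rw [key f hf, key _ (hmaps hf)]
    refine ⟨McN.neg_mem h4, ?_⟩
    rw [hneg _ h4, hadd _ h2 _ h3, hneg _ h1, hneg _ hb, hadd _ ha _ hf, ha', hb']

theorem IsMVEndo.map_one (hσ : IsMVEndo P σ) : σ (fun _ => 1) = fun _ => 1 := by
  have h := hσ.2.2.1 _ McN.zero_mem
  have hone : mvNeg (fun _ : P => (0 : ℝ)) = fun _ => 1 := funext fun _ => sub_zero 1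
  rwa [hσ.2.1, hone] at h

/-- A member of `McN P` whose image under an endomorphism vanishes somewhere has a zero. -/
theorem IsMVEndo.exists_eq_zero (hP : P ⊆ cube n) (hc : IsCompact P) (hσ : IsMVEndo P σ)
    {f : P → ℝ} (hf : f ∈ McN P) {x : P} (hx : σ f x = 0) : ∃ y, f y = 0 := by
  by_contra! hne
  have : CompactSpace P := isCompact_iff_compactSpace.mp hc
  obtain ⟨y, -, hy⟩ := isCompact_univ.exists_isMinOn ⟨x, mem_univ x⟩
    (McN.continuous hP hf).continuousOn
  have hy0 : 0 < f y := lt_of_le_of_ne (McN.mem_Icc hP hf y).1 (hne y).symm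
  obtain ⟨q, hq⟩ := exists_nat_ge (1 / f y)
  have hq1 : (1 : ℝ) ≤ q * f y := (div_le_iff₀ hy0).mp hq
  have h1 : (fun z => unitClip (q * f z - (0 : ℤ))) = fun _ => 1 := by
    funext z
    have hz : f y ≤ f z := hy (mem_univ z)
    have : (1 : ℝ) ≤ q * f z := hq1.trans (by gcongr)
    simp [unitClip, this]
  have h2 := (hσ.map_unitClip hP hf q 0).2
  rw [h1, hσ.map_one] at h2
  simpa [hx, unitClip] using congrFun h2 x

/-- Every endomorphism of `McN P`, for compact `P`, is composition with a self-map of `P`. -/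
theorem IsMVEndo.exists_comp (hP : P ⊆ cube n) (hc : IsCompact P) (hσ : IsMVEndo P σ) :
    ∃ g : P → P, ∀ f ∈ McN P, ∀ x, σ f x = f (g x) := by
  suffices H : ∀ x : P, ∃ y : P, ∀ f ∈ McN P, σ f x = f y by
    choose g hg using H
    exact ⟨g, fun f hf x => hg x f hf⟩
  intro x
  have : CompactSpace P := isCompact_iff_compactSpace.mp hc
  let K := {f : P → ℝ // f ∈ McN P ∧ σ f x = 0}
  have : Nonempty K := ⟨⟨_, McN.zero_mem, congrFun hσ.2.1 x⟩⟩
  have hclosed : ∀ f : K, IsClosed {y | f.1 y = 0} := fun f =>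
    isClosed_eq (McN.continuous hP f.2.1) continuous_const
  obtain ⟨y, hy⟩ := IsCompact.nonempty_iInter_of_directed_nonempty_isCompact_isClosed
    (fun f : K => {y | f.1 y = 0})
    (fun f g => ⟨⟨mvOplus f.1 g.1, McN.oplus_mem f.2.1 g.2.1, by
        simp [hσ.2.2.2 _ f.2.1 _ g.2.1, mvOplus, f.2.2, g.2.2]⟩, by
      have key : ∀ y, mvOplus f.1 g.1 y = 0 → f.1 y = 0 ∧ g.1 y = 0 := by
        intro y hy
        have h1 := (McN.mem_Icc hP f.2.1 y).1
        have h2 := (McN.mem_Icc hP g.2.1 y).1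
        simp only [mvOplus] at hy
        grind
      exact ⟨fun y hy => (key y hy).1, fun y hy => (key y hy).2⟩⟩)
    (fun f => hσ.exists_eq_zero hP hc f.2.1 f.2.2)
    (fun f => (hclosed f).isCompact) hclosed
  have hle : ∀ f ∈ McN P, f y ≤ σ f x := by
    intro f hf
    by_contra! hlt
    obtain ⟨r, hr1, hr2⟩ := exists_rat_btwn hlt
    obtain ⟨hm, he⟩ := hσ.map_unitClip hP hf r.den r.num
    have hd : (0 : ℝ) < r.den := by exact_mod_cast r.den_pos
    have hr : (r : ℝ) * r.den = r.num := by exact_mod_cast Rat.mul_den_eq_num r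
    have h0 : σ (fun x => unitClip (r.den * f x - r.num)) x = 0 := by
      rw [he]
      have : (r.den : ℝ) * σ f x - r.num ≤ 0 := by nlinarith
      simp [unitClip, this]
    have h1 : unitClip (r.den * f y - r.num) = 0 := mem_iInter.mp hy ⟨_, hm, h0⟩
    have h2 : (0 : ℝ) < r.den * f y - r.num := by nlinarith
    unfold unitClip at h1
    grind
  refine ⟨y, fun f hf => le_antisymm ?_ (hle f hf)⟩
  have h := hle _ (McN.neg_mem hf)
  rw [hσ.2.2.1 _ hf] at h
  simp only [mvNeg] at h
  linarith

end Endo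

theorem finite_subtype_int_mul {n : ℕ} {P : Set (Fin n → ℝ)} (hP : P ⊆ cube n) {d : ℕ}
    (hd : d ≠ 0) : {x : P | ∀ i, ∃ z : ℤ, (d : ℝ) * x.1 i = z}.Finite := by
  have hd' : (0 : ℝ) < d := by positivity
  have hfin : (Set.univ.pi fun _ : Fin n => (fun z : ℤ => (z : ℝ) / d) '' Set.Icc 0 d).Finite :=
    Set.Finite.pi fun _ => (Set.finite_Icc _ _).image _
  refine (hfin.preimage Subtype.val_injective.injOn).subset fun x hx => ?_
  intro i _
  obtain ⟨z, hz⟩ := hx i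
  have h0 : 0 ≤ x.1 i := (hP x.2).1 i
  have h1 : x.1 i ≤ 1 := (hP x.2).2 i
  refine ⟨z, ⟨?_, ?_⟩, ?_⟩
  · have : (0 : ℝ) ≤ z := hz ▸ by positivity
    exact_mod_cast this
  · have : (z : ℝ) ≤ d := by nlinarith
    exact_mod_cast this
  · simp only [← hz]
    field_simp

theorem IsRationalPoint.exists_int_mul {n : ℕ} {x : Fin n → ℝ} (hx : IsRationalPoint x) :
    ∃ d : ℕ, d ≠ 0 ∧ ∀ i, ∃ z : ℤ, (d : ℝ) * x i = z := by
  choose q hq using hx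
  refine ⟨∏ i, (q i).den, Finset.prod_ne_zero_iff.mpr fun i _ => (q i).den_nz, fun i => ?_⟩
  obtain ⟨k, hk⟩ := Finset.dvd_prod_of_mem (fun i => (q i).den) (Finset.mem_univ i)
  refine ⟨k * (q i).num, ?_⟩
  have hr : ((q i : ℚ) : ℝ) * (q i).den = (q i).num := by exact_mod_cast Rat.mul_den_eq_num (q i)
  rw [hk, hq i]
  push_cast
  rw [← hr]
  ring

/-- Rational points are dense in the convex hull of a set of rational points. -/
theorem convexHull_subset_closure_rational {n : ℕ} {S : Set (Fin n → ℝ)}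
    (hS : ∀ v ∈ S, IsRationalPoint v) :
    convexHull ℝ S ⊆ closure {x | x ∈ convexHull ℝ S ∧ IsRationalPoint x} := by
  refine convexHull_min (fun v hv => subset_closure ⟨subset_convexHull ℝ S hv, hS v hv⟩) ?_
  rw [convex_iff_openSegment_subset]
  intro a ha b hb
  rw [openSegment_eq_image]
  rintro _ ⟨t, ht, rfl⟩
  have ht' : t ∈ closure (Set.Ioo (0 : ℝ) 1 ∩ Set.range ((↑) : ℚ → ℝ)) :=
    Rat.denseRange_cast.open_subset_closure_inter isOpen_Ioo ht
  have hmem : ((a, b), t) ∈ closure (({x | x ∈ convexHull ℝ S ∧ IsRationalPoint x} ×ˢ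
      {x | x ∈ convexHull ℝ S ∧ IsRationalPoint x}) ×ˢ
      (Set.Ioo (0 : ℝ) 1 ∩ Set.range ((↑) : ℚ → ℝ))) := by
    simp only [closure_prod_eq]
    exact ⟨⟨ha, hb⟩, ht'⟩
  refine map_mem_closure
    (f := fun w : ((Fin n → ℝ) × (Fin n → ℝ)) × ℝ => (1 - w.2) • w.1.1 + w.2 • w.1.2)
    (by fun_prop) hmem ?_
  rintro ⟨⟨u, v⟩, _⟩ ⟨⟨⟨hu, hu'⟩, hv, hv'⟩, hs, r, rfl⟩
  refine ⟨convex_convexHull ℝ S hu hv (by linarith [hs.2]) hs.1.le (by ring), fun i => ?_⟩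
  obtain ⟨p, hp⟩ := hu' i
  obtain ⟨q, hq⟩ := hv' i
  exact ⟨(1 - r) * p + r * q, by simp [show u i = p from hp, show v i = q from hq]⟩

theorem IsRatPolyhedron.subset_cube {n : ℕ} {P : Set (Fin n → ℝ)} (hP : IsRatPolyhedron P) :
    P ⊆ cube n := by
  obtain ⟨F, hF, rfl⟩ := hP
  exact iUnion₂_subset fun S hS => convexHull_min (fun v hv => (hF S hS v hv).2) (convex_Icc 0 1)

theorem IsRatPolyhedron.isCompact {n : ℕ} {P : Set (Fin n → ℝ)} (hP : IsRatPolyhedron P) :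
    IsCompact P := by
  obtain ⟨F, -, rfl⟩ := hP
  exact F.isCompact_biUnion fun S _ => S.finite_toSet.isCompact_convexHull (𝕜 := ℝ)

theorem IsRatPolyhedron.dense_rational {n : ℕ} {P : Set (Fin n → ℝ)} (hP : IsRatPolyhedron P) :
    Dense {x : P | IsRationalPoint x.1} := by
  obtain ⟨F, hF, rfl⟩ := hP
  rintro ⟨x, hx⟩
  rw [closure_subtype]
  obtain ⟨S, hS, hxS⟩ := mem_iUnion₂.mp hx
  refine closure_mono ?_
    (convexHull_subset_closure_rational (fun v hv => (hF S hS v hv).1) hxS)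
  rintro y ⟨hy, hr⟩
  exact ⟨⟨y, mem_iUnion₂.mpr ⟨S, hS, hy⟩⟩, hr, rfl⟩

/-- for every nonempty rational polyhedron `P ⊆ [0,1]^n`, the finitely
presented MV-algebra `McN(P)` is hopfian: every surjective MV-endomorphism is injective. -/
theorem stmt3 {n : ℕ} (hn : 1 ≤ n) (P : Set (Fin n → ℝ))
    (hP : IsRatPolyhedron P) (hne : P.Nonempty) :
    ∀ σ : (↥P → ℝ) → (↥P → ℝ), IsMVEndo P σ →
      Set.SurjOn σ (McN P) (McN P) → Set.InjOn σ (McN P) := by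
  intro σ hσ hsurj
  have hcube := hP.subset_cube
  obtain ⟨g, hg⟩ := hσ.exists_comp hcube hP.isCompact
  have hinj : Function.Injective g := by
    intro x y hxy
    refine Subtype.ext (funext fun i => ?_)
    obtain ⟨f, hf, hfi⟩ := hsurj (McN.apply_mem i)
    have hx := congrFun hfi x
    have hy := congrFun hfi y
    rw [hg f hf] at hx hy
    rw [← hx, ← hy, hxy]
  have hrange : ∀ x : P, IsRationalPoint x.1 → ∃ y, g y = x := by
    intro x hx
    obtain ⟨d, hd, hxd⟩ := hx.exists_int_mul
    have hmaps : Set.MapsTo g {x : P | ∀ i, ∃ z : ℤ, (d : ℝ) * x.1 i = z}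
        {x : P | ∀ i, ∃ z : ℤ, (d : ℝ) * x.1 i = z} := by
      intro y hy i
      have h := McN.exists_int_mul hcube (hσ.1 (McN.apply_mem i)) d hy
      rwa [hg _ (McN.apply_mem i)] at h
    have himage := Set.eq_of_subset_of_ncard_le hmaps.image_subset
      (Set.ncard_image_of_injective _ hinj).ge (finite_subtype_int_mul hcube hd)
    obtain ⟨y, -, hy⟩ := himage.ge hxd
    exact ⟨y, hy⟩
  intro f hf f' hf' heq
  refine Continuous.ext_on hP.dense_rational (McN.continuous hcube hf)
    (McN.continuous hcube hf') fun x hx => ?_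
  obtain ⟨y, rfl⟩ := hrange x hx
  rw [← hg f hf, ← hg f' hf', heq]
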